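/- arXiv:1501.03908 — 2 statements merged into one kernel-verified Lean document; each statement's English description precedes it below -/
import Mathlib

section
/- For every t ∈ [0,1], the map f_t maps Ω^I_{2,2} into Ω^I_{4,4}, i.e. I_4 − f_t(Z) f_t(Z)ᴴ is positive definite whenever I_2 − Z Zᴴ is positive definite, and the restriction f_t : Ω^I_{2,2} → Ω^I_{4,4} is a proper map (the preimage of every compact subset of Ω^I_{4,4} is compact). -/
open Matrix
open scoped ComplexOrder

noncomputable section

/-- The type I classical bounded symmetric domain `Ω^I_{r,s}`. -/
def OmegaI (r s : ℕ) : Set (Matrix (Fin r) (Fin s) ℂ) :=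
  {Z | (1 - Z * Zᴴ).PosDef}

/-- Properness of the restriction `Ω₁ → Ω₂`. -/
def IsProperOn {E F : Type*} [TopologicalSpace E] [TopologicalSpace F]
    (f : E → F) (Ω₁ : Set E) (Ω₂ : Set F) : Prop :=
  ∀ K : Set F, K ⊆ Ω₂ → IsCompact K → IsCompact (Ω₁ ∩ f ⁻¹' K)

/-- The one-parameter family `f_t : Ω^I_{2,2} → Ω^I_{4,4}` of equation (4.1). -/
def ft (t : ℝ) (Z : Matrix (Fin 2) (Fin 2) ℂ) : Matrix (Fin 4) (Fin 4) ℂ :=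
  !![Z 0 0 ^ 2, (Real.sqrt (2 - t) : ℂ) * Z 0 0 * Z 0 1,
      (Real.sqrt (1 - t) : ℂ) * Z 0 1 ^ 2, (Real.sqrt t : ℂ) * Z 0 1;
    (Real.sqrt (2 - t) : ℂ) * Z 0 0 * Z 1 0,
      ((2 * (1 - t) / (2 - t) : ℝ) : ℂ) * Z 0 0 * Z 1 1 + Z 0 1 * Z 1 0,
      ((2 * Real.sqrt ((1 - t) / (2 - t)) : ℝ) : ℂ) * Z 0 1 * Z 1 1,
      (Real.sqrt (t / (2 - t)) : ℂ) * Z 1 1;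
    (Real.sqrt (1 - t) : ℂ) * Z 1 0 ^ 2,
      ((2 * Real.sqrt ((1 - t) / (2 - t)) : ℝ) : ℂ) * Z 1 0 * Z 1 1, Z 1 1 ^ 2, 0;
    (Real.sqrt t : ℂ) * Z 1 0, (Real.sqrt (t / (2 - t)) : ℂ) * Z 1 1, 0, 0]

open Complex (normSq)

/-- Membership in `Ω^I_{r,s}` says that `Zᴴ` strictly decreases the Euclidean norm. -/
theorem mem_OmegaI_iff {r s : ℕ} {Z : Matrix (Fin r) (Fin s) ℂ} :
    Z ∈ OmegaI r s ↔ ∀ x : Fin r → ℂ, x ≠ 0 →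
      ∑ i, normSq ((Zᴴ *ᵥ x) i) < ∑ i, normSq (x i) := by
  have hdot : ∀ {n : ℕ} (y : Fin n → ℂ), star y ⬝ᵥ y = ((∑ i, normSq (y i) : ℝ) : ℂ) := by
    intro n y
    simp [dotProduct, Complex.normSq_eq_conj_mul_self]
  have hquad : ∀ x : Fin r → ℂ, star x ⬝ᵥ ((1 - Z * Zᴴ) *ᵥ x) =
      ((∑ i, normSq (x i) - ∑ i, normSq ((Zᴴ *ᵥ x) i) : ℝ) : ℂ) := by
    intro x
    rw [Complex.ofReal_sub, ← hdot, ← hdot, sub_mulVec, one_mulVec, dotProduct_sub,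
      ← mulVec_mulVec, dotProduct_mulVec, star_mulVec, conjTranspose_conjTranspose]
  have hherm : (1 - Z * Zᴴ).IsHermitian :=
    isHermitian_one.sub (isHermitian_mul_conjTranspose_self Z)
  rw [OmegaI, Set.mem_ofPred_eq, posDef_iff_dotProduct_mulVec]
  simp only [hherm, true_and, hquad, Complex.zero_lt_real, sub_pos]

theorem normSq_rotation_le {α γ : ℝ} (h : α ^ 2 + γ ^ 2 = 1) (u v : ℂ) :
    normSq (α * u + γ * v) ≤ normSq u + normSq v := by
  simp only [Complex.normSq_apply, Complex.add_re, Complex.add_im, Complex.re_ofReal_mul,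
    Complex.im_ofReal_mul]
  have hu : ∀ p q : ℝ, (α * p + γ * q) * (α * p + γ * q) ≤ p * p + q * q := by
    intro p q
    have : p * p + q * q - (α * p + γ * q) * (α * p + γ * q) = (γ * p - α * q) ^ 2 := by
      linear_combination (-(p * p) - q * q) * h
    nlinarith [sq_nonneg (γ * p - α * q)]
  linarith [hu u.re v.re, hu u.im v.im]

theorem ft_conjTranspose (t : ℝ) (Z : Matrix (Fin 2) (Fin 2) ℂ) : (ft t Z)ᴴ = ft t Zᴴ := by
  ext i j
  fin_cases i <;> fin_cases j <;> simp [ft, conjTranspose_apply] <;> ring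

theorem continuous_ft (t : ℝ) : Continuous (ft t) := by
  refine continuous_matrix fun i j => ?_
  fin_cases i <;> fin_cases j <;> simp [ft] <;> fun_prop

/-- The matrix `f_t(Z)` in terms of the radicals `a = √(1 - t)`, `b = √t`, `e = √(2 - t)`. -/
def ftRadical (a b e : ℝ) (Z : Matrix (Fin 2) (Fin 2) ℂ) : Matrix (Fin 4) (Fin 4) ℂ :=
  !![Z 0 0 ^ 2, e * Z 0 0 * Z 0 1, a * Z 0 1 ^ 2, b * Z 0 1;
    e * Z 0 0 * Z 1 0, (2 * a ^ 2 / e ^ 2) * Z 0 0 * Z 1 1 + Z 0 1 * Z 1 0,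
      (2 * (a / e)) * Z 0 1 * Z 1 1, (b / e) * Z 1 1;
    a * Z 1 0 ^ 2, (2 * (a / e)) * Z 1 0 * Z 1 1, Z 1 1 ^ 2, 0;
    b * Z 1 0, (b / e) * Z 1 1, 0, 0]

theorem exists_ft_eq_ftRadical {t : ℝ} (ht : t ∈ Set.Icc (0 : ℝ) 1) :
    ∃ a b e : ℝ, 0 < e ∧ a ^ 2 + b ^ 2 = 1 ∧ e ^ 2 = 1 + a ^ 2 ∧ ft t = ftRadical a b e := by
  obtain ⟨h0, h1⟩ := ht
  have he : √(2 - t) ^ 2 = 2 - t := Real.sq_sqrt (by linarith)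
  have ha : √(1 - t) ^ 2 = 1 - t := Real.sq_sqrt (by linarith)
  have hb : √t ^ 2 = t := Real.sq_sqrt h0
  have hk : 2 * (1 - t) / (2 - t) = 2 * √(1 - t) ^ 2 / √(2 - t) ^ 2 := by rw [ha, he]
  refine ⟨√(1 - t), √t, √(2 - t), Real.sqrt_pos.2 (by linarith), by linarith, by linarith, ?_⟩
  ext Z : 1
  rw [ft, ftRadical, Real.sqrt_div (by linarith), Real.sqrt_div h0, hk]
  push_cast
  rfl

/-- If `W` strictly decreases norms, so does `ftRadical a b e W`: it factors through two copies of
`W ⊕ W ⊕ 1`, separated by contractions. -/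
theorem normSq_ftRadical_mulVec_lt {a b e : ℝ} (he0 : 0 < e) (hab : a ^ 2 + b ^ 2 = 1)
    (hae : e ^ 2 = 1 + a ^ 2) (W : Matrix (Fin 2) (Fin 2) ℂ)
    (hW : ∀ x : Fin 2 → ℂ, x ≠ 0 → ∑ i, normSq ((W *ᵥ x) i) < ∑ i, normSq (x i))
    (v : Fin 4 → ℂ) (hv : v ≠ 0) :
    ∑ i, normSq ((ftRadical a b e W *ᵥ v) i) < ∑ i, normSq (v i) := by
  have hne : (e : ℂ) ≠ 0 := by exact_mod_cast he0.ne'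
  have haeC : (e : ℂ) ^ 2 = 1 + (a : ℂ) ^ 2 := by exact_mod_cast hae
  have hβγ : (1 / e) ^ 2 + (a / e) ^ 2 = 1 := by
    field_simp; linarith
  have hWle : ∀ x : Fin 2 → ℂ, ∑ i, normSq ((W *ᵥ x) i) ≤ ∑ i, normSq (x i) := by
    intro x
    rcases eq_or_ne x 0 with rfl | hx
    · simp
    · exact (hW x hx).le
  set p : Fin 2 → ℂ := ![v 0, (1 / e : ℝ) * v 1] with hp
  set q : Fin 2 → ℂ := ![(a / e : ℝ) * v 1, v 2] with hq
  set r : Fin 2 → ℂ := ![(W *ᵥ p) 0, (a : ℂ) * (W *ᵥ q) 0 + b * v 3] with hr'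
  set s : Fin 2 → ℂ := ![(a : ℂ) * (W *ᵥ p) 1, (W *ᵥ q) 1] with hs
  have o0 : (ftRadical a b e W *ᵥ v) 0 = (W *ᵥ r) 0 := by
    rw [ftRadical]
    simp [mulVec, dotProduct, Fin.sum_univ_succ, hp, hq, hr']
    field_simp
    linear_combination (W 0 0 * W 0 1 * v 1) * haeC
  have o1 : (ftRadical a b e W *ᵥ v) 1 = (1 / e : ℝ) * (W *ᵥ r) 1 + (a / e : ℝ) * (W *ᵥ s) 0 := by
    rw [ftRadical]
    simp [mulVec, dotProduct, Fin.sum_univ_succ, hp, hq, hr', hs]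
    field_simp
    linear_combination (W 0 0 * W 1 0 * v 0 * e + W 0 1 * W 1 0 * v 1) * haeC
  have o2 : (ftRadical a b e W *ᵥ v) 2 = (W *ᵥ s) 1 := by
    rw [ftRadical]
    simp [mulVec, dotProduct, Fin.sum_univ_succ, hp, hq, hs]
    field_simp
    ring
  have o3 : (ftRadical a b e W *ᵥ v) 3 = b * (W *ᵥ p) 1 := by
    rw [ftRadical]
    simp [mulVec, dotProduct, Fin.sum_univ_succ, hp]
    field_simp
  have nv : ∑ i, normSq (v i) = ∑ i, normSq (p i) + ∑ i, normSq (q i) + normSq (v 3) := by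
    simp only [Fin.sum_univ_four, Fin.sum_univ_two, hp, hq, cons_val_zero, cons_val_one,
      Complex.normSq_mul, Complex.normSq_ofReal]
    linear_combination (-normSq (v 1)) * hβγ
  have nf : ∑ i, normSq ((ftRadical a b e W *ᵥ v) i) ≤
      ∑ i, normSq ((W *ᵥ r) i) + ∑ i, normSq ((W *ᵥ s) i) + b ^ 2 * normSq ((W *ᵥ p) 1) := by
    have := normSq_rotation_le hβγ ((W *ᵥ r) 1) ((W *ᵥ s) 0)
    simp only [Fin.sum_univ_four, Fin.sum_univ_two, o0, o1, o2, o3,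
      Complex.normSq_mul b, Complex.normSq_ofReal]
    linarith
  have nm : ∑ i, normSq (r i) + ∑ i, normSq (s i) + b ^ 2 * normSq ((W *ᵥ p) 1) ≤
      ∑ i, normSq ((W *ᵥ p) i) + ∑ i, normSq ((W *ᵥ q) i) + normSq (v 3) := by
    have := normSq_rotation_le hab ((W *ᵥ q) 0) (v 3)
    simp only [Fin.sum_univ_two, hr', hs, cons_val_zero, cons_val_one,
      Complex.normSq_mul a, Complex.normSq_ofReal]
    linear_combination this + normSq ((W *ᵥ p) 1) * hab
  have lp := hWle p
  have lq := hWle q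
  have lr := hWle r
  have ls := hWle s
  by_cases p0 : p = 0
  · by_cases q0 : q = 0
    · have z0 : v 0 = 0 := by simpa [hp] using congrFun p0 0
      have z1 : v 1 = 0 := by simpa [hp, he0.ne'] using congrFun p0 1
      have z2 : v 2 = 0 := by simpa [hq] using congrFun q0 1
      have z3 : v 3 ≠ 0 := by
        intro z3
        apply hv
        ext i
        fin_cases i <;> simp [z0, z1, z2, z3]
      by_cases b0 : b = 0
      · have r0 : r = 0 := by
          ext i
          fin_cases i <;> simp [hr', p0, q0, b0]
        have s0 : s = 0 := by
          ext i
          fin_cases i <;> simp [hs, p0, q0]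
        have := Complex.normSq_pos.2 z3
        simp [r0, s0, p0, q0] at nf nv
        linarith
      · have r0 : r ≠ 0 := by
          intro h
          have := congrFun h 1
          simp [hr', q0, b0, z3] at this
        linarith [hW r r0]
    · linarith [hW q q0]
  · linarith [hW p p0]

/-- An isometric vector of `W` yields a vector whose norm `ftRadical a b e W` does not decrease. -/
theorem exists_le_normSq_ftRadical_mulVec {a b e : ℝ} (he0 : 0 < e) (hab : a ^ 2 + b ^ 2 = 1)
    (hae : e ^ 2 = 1 + a ^ 2)
    (W : Matrix (Fin 2) (Fin 2) ℂ) (x : Fin 2 → ℂ) (hx : x ≠ 0)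
    (hWx : ∑ i, normSq ((W *ᵥ x) i) = ∑ i, normSq (x i)) :
    ∃ v : Fin 4 → ℂ, v ≠ 0 ∧ ∑ i, normSq (v i) ≤ ∑ i, normSq ((ftRadical a b e W *ᵥ v) i) := by
  have hne : (e : ℂ) ≠ 0 := by exact_mod_cast he0.ne'
  have haeC : (e : ℂ) ^ 2 = 1 + (a : ℂ) ^ 2 := by exact_mod_cast hae
  have habC : (a : ℂ) ^ 2 + (b : ℂ) ^ 2 = 1 := by exact_mod_cast hab
  have y0 : (W *ᵥ x) 0 = W 0 0 * x 0 + W 0 1 * x 1 := by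
    simp [mulVec, dotProduct, Fin.sum_univ_two]
  have y1 : (W *ᵥ x) 1 = W 1 0 * x 0 + W 1 1 * x 1 := by
    simp [mulVec, dotProduct, Fin.sum_univ_two]
  rw [Fin.sum_univ_two, Fin.sum_univ_two] at hWx
  by_cases hv : (![x 0 ^ 2, e * x 0 * x 1, a * x 1 ^ 2, b * x 1 * (W *ᵥ x) 0] : Fin 4 → ℂ) = 0
  · have x0 : x 0 = 0 := by simpa using congrFun hv 0
    have x1 : x 1 ≠ 0 := by
      intro x1
      apply hx
      ext i
      fin_cases i <;> simp [x0, x1]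
    have a0 : a = 0 := by simpa [x1] using congrFun hv 2
    have b0 : b ≠ 0 := by
      rintro rfl
      simp [a0] at hab
    have hy0 : (W *ᵥ x) 0 = 0 := by simpa [x1, b0] using congrFun hv 3
    have hW11 : normSq (W 1 1) = 1 := by
      rw [hy0, y1, x0] at hWx
      simpa [Complex.normSq_mul, x1] using hWx
    refine ⟨![0, 0, 1, 0], fun h => by simpa using congrFun h 2, ?_⟩
    have o2 : (ftRadical a b e W *ᵥ ![0, 0, 1, 0]) 2 = W 1 1 ^ 2 := by
      rw [ftRadical]
      simp [mulVec, dotProduct, Fin.sum_univ_succ]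
    have := Finset.single_le_sum (f := fun i => normSq ((ftRadical a b e W *ᵥ ![0, 0, 1, 0]) i))
      (fun i _ => Complex.normSq_nonneg _) (Finset.mem_univ 2)
    rw [o2, map_pow, hW11] at this
    simpa [Fin.sum_univ_four] using this
  · refine ⟨_, hv, ?_⟩
    set v : Fin 4 → ℂ := ![x 0 ^ 2, e * x 0 * x 1, a * x 1 ^ 2, b * x 1 * (W *ᵥ x) 0] with hv'
    have o0 : (ftRadical a b e W *ᵥ v) 0 = (W *ᵥ x) 0 ^ 2 := by
      rw [ftRadical]
      simp [mulVec, dotProduct, Fin.sum_univ_succ, hv']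
      linear_combination (W 0 0 * W 0 1 * x 0 * x 1) * (haeC + habC) +
        (W 0 1 ^ 2 * x 1 ^ 2) * habC
    have o1 : (ftRadical a b e W *ᵥ v) 1 = e * (W *ᵥ x) 0 * (W *ᵥ x) 1 := by
      rw [ftRadical]
      simp [mulVec, dotProduct, Fin.sum_univ_succ, hv']
      field_simp
      linear_combination (W 1 1 * x 1 * (W 0 0 * x 0 + W 0 1 * x 1)) * (habC - haeC)
    have o2 : (ftRadical a b e W *ᵥ v) 2 = a * (W *ᵥ x) 1 ^ 2 := by
      rw [ftRadical]
      simp [mulVec, dotProduct, Fin.sum_univ_succ, hv']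
      field_simp
      ring
    have o3 : (ftRadical a b e W *ᵥ v) 3 = b * x 0 * (W *ᵥ x) 1 := by
      rw [ftRadical]
      simp [mulVec, dotProduct, Fin.sum_univ_succ, hv']
      field_simp
    rw [Fin.sum_univ_four, Fin.sum_univ_four, o0, o1, o2, o3]
    simp only [hv', cons_val, Complex.normSq_mul, Complex.normSq_ofReal, map_pow]
    simp only [← sq, hae]
    rw [show a ^ 2 = 1 - b ^ 2 by linarith]
    generalize normSq (x 0) = X at *
    generalize normSq (x 1) = X' at *
    generalize normSq ((W *ᵥ x) 0) = Y at *
    generalize normSq ((W *ᵥ x) 1) = Y' at *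
    obtain rfl : Y = X + X' - Y' := by linarith
    apply le_of_eq
    ring

theorem ft_mapsTo {t : ℝ} (ht : t ∈ Set.Icc (0 : ℝ) 1) :
    Set.MapsTo (ft t) (OmegaI 2 2) (OmegaI 4 4) := by
  intro Z hZ
  rw [mem_OmegaI_iff] at hZ ⊢
  obtain ⟨a, b, e, he0, hab, hae, hft⟩ := exists_ft_eq_ftRadical ht
  rw [ft_conjTranspose, hft]
  exact normSq_ftRadical_mulVec_lt he0 hab hae Zᴴ hZ

theorem isCompact_setOf_normSq_mulVec_le {m n : ℕ} :
    IsCompact {Z : Matrix (Fin m) (Fin n) ℂ |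
      ∀ x : Fin m → ℂ, ∑ i, normSq ((Zᴴ *ᵥ x) i) ≤ ∑ i, normSq (x i)} := by
  have hK : IsCompact (Set.univ.pi fun _ : Fin m => Set.univ.pi fun _ : Fin n =>
      Metric.closedBall (0 : ℂ) 1) :=
    isCompact_univ_pi fun _ => isCompact_univ_pi fun _ => isCompact_closedBall _ _
  refine IsCompact.of_isClosed_subset hK ?_ ?_
  · simp only [Set.ofPred_forall]
    refine isClosed_iInter fun x => isClosed_le ?_ continuous_const
    refine continuous_finsetSum _ fun i _ => Complex.continuous_normSq.comp ?_
    exact (continuous_apply i).comp (continuous_id.matrix_conjTranspose.matrix_mulVec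
      continuous_const)
  · intro Z hZ i _ j _
    have h := hZ (Pi.single i 1)
    have h1 : ∑ k, normSq ((Pi.single i 1 : Fin m → ℂ) k) = 1 := by
      rw [Finset.sum_eq_single i] <;> simp +contextual
    have h2 := Finset.single_le_sum (f := fun k => normSq ((Zᴴ *ᵥ Pi.single i 1) k))
      (fun k _ => Complex.normSq_nonneg _) (Finset.mem_univ j)
    simp only [mulVec_single_one, col_apply, conjTranspose_apply] at h h2
    rw [h1] at h
    have h3 : normSq (Z i j) ≤ 1 := by simpa using h2.trans h
    rw [Complex.normSq_eq_norm_sq] at h3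
    rw [mem_closedBall_zero_iff]
    nlinarith [norm_nonneg (Z i j)]

theorem ft_isProperOn {t : ℝ} (ht : t ∈ Set.Icc (0 : ℝ) 1) :
    IsProperOn (ft t) (OmegaI 2 2) (OmegaI 4 4) := by
  intro K hK hKc
  have heq : OmegaI 2 2 ∩ ft t ⁻¹' K = {Z : Matrix (Fin 2) (Fin 2) ℂ |
      ∀ x : Fin 2 → ℂ, ∑ i, normSq ((Zᴴ *ᵥ x) i) ≤ ∑ i, normSq (x i)} ∩ ft t ⁻¹' K := by
    ext Z
    refine and_congr_left fun hZK => ⟨fun hZ x => ?_, fun hZ => ?_⟩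
    · rcases eq_or_ne x 0 with rfl | hx
      · simp
      · exact (mem_OmegaI_iff.1 hZ x hx).le
    · refine mem_OmegaI_iff.2 fun x hx => (hZ x).lt_of_ne fun h => ?_
      obtain ⟨a, b, e, he0, hab, hae, hft⟩ := exists_ft_eq_ftRadical ht
      obtain ⟨v, hv, hle⟩ := exists_le_normSq_ftRadical_mulVec he0 hab hae Zᴴ x hx h
      have := mem_OmegaI_iff.1 (hK hZK) v hv
      rw [ft_conjTranspose, hft] at this
      exact absurd this hle.not_gt
  rw [heq]
  exact isCompact_setOf_normSq_mulVec_le.inter_right (hKc.isClosed.preimage (continuous_ft t))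

/-- Each `f_t`, `t ∈ [0,1]`, is a proper holomorphic map from `Ω^I_{2,2}` to `Ω^I_{4,4}`. -/
theorem ft_mapsTo_and_proper (t : ℝ) (ht : t ∈ Set.Icc (0 : ℝ) 1) :
    Set.MapsTo (ft t) (OmegaI 2 2) (OmegaI 4 4) ∧
      IsProperOn (ft t) (OmegaI 2 2) (OmegaI 4 4) :=
  ⟨ft_mapsTo ht, ft_isProperOn ht⟩
end
end

section
/- Let t, t' ∈ [0,1] with t ≠ t'. Then the maps h_t and h_{t'} are inequivalent as maps from Ω^III_2 to Ω^III_4: there do not exist automorphisms τ of Ω^III_2 and σ of Ω^III_4 such that h_t(Z) = σ(h_{t'}(τ(Z))) for all Z ∈ Ω^III_2. Consequently there are uncountably many pairwise inequivalent proper holomorphic maps from Ω^III_2 to Ω^III_4. -/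
open Matrix
open scoped ComplexOrder

noncomputable section

attribute [local instance] Matrix.normedAddCommGroup Matrix.normedSpace

/-- The type III classical bounded symmetric domain `Ω^III_n` of symmetric matrices. -/
def OmegaIII (n : ℕ) : Set (Matrix (Fin n) (Fin n) ℂ) :=
  {Z | Zᵀ = Z ∧ (1 - Z * Zᴴ).PosDef}

/-- `τ` is an automorphism of the domain `Ω`: a holomorphic bijection of `Ω` onto itself
with holomorphic inverse. -/
def IsAutomorphismOf {E : Type*} [NormedAddCommGroup E] [NormedSpace ℂ E]
    (Ω : Set E) (τ : E → E) : Prop :=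
  Set.MapsTo τ Ω Ω ∧ DifferentiableOn ℂ τ Ω ∧
    ∃ τinv : E → E, Set.MapsTo τinv Ω Ω ∧ DifferentiableOn ℂ τinv Ω ∧
      (∀ z ∈ Ω, τinv (τ z) = z) ∧ (∀ z ∈ Ω, τ (τinv z) = z)

/-- The one-parameter family `h_t : Ω^III_2 → Ω^III_4` (restriction of (4.1) to symmetric
matrices), where `z₁ = Z 0 0`, `z₂ = Z 0 1 = Z 1 0`, `z₃ = Z 1 1`. -/
def ht (t : ℝ) (Z : Matrix (Fin 2) (Fin 2) ℂ) : Matrix (Fin 4) (Fin 4) ℂ :=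
  !![Z 0 0 ^ 2, (Real.sqrt (2 - t) : ℂ) * Z 0 0 * Z 0 1,
      (Real.sqrt (1 - t) : ℂ) * Z 0 1 ^ 2, (Real.sqrt t : ℂ) * Z 0 1;
    (Real.sqrt (2 - t) : ℂ) * Z 0 0 * Z 0 1,
      ((2 * (1 - t) / (2 - t) : ℝ) : ℂ) * Z 0 0 * Z 1 1 + Z 0 1 ^ 2,
      ((2 * Real.sqrt ((1 - t) / (2 - t)) : ℝ) : ℂ) * Z 0 1 * Z 1 1,
      (Real.sqrt (t / (2 - t)) : ℂ) * Z 1 1;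
    (Real.sqrt (1 - t) : ℂ) * Z 0 1 ^ 2,
      ((2 * Real.sqrt ((1 - t) / (2 - t)) : ℝ) : ℂ) * Z 0 1 * Z 1 1, Z 1 1 ^ 2, 0;
    (Real.sqrt t : ℂ) * Z 0 1, (Real.sqrt (t / (2 - t)) : ℂ) * Z 1 1, 0, 0]


/-- The squared Euclidean norm of a complex vector. -/
def vecNormSq {n : ℕ} (v : Fin n → ℂ) : ℝ := ∑ i, Complex.normSq (v i)

lemma star_dotProduct_self {n : ℕ} (v : Fin n → ℂ) : star v ⬝ᵥ v = (vecNormSq v : ℂ) := by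
  simp [dotProduct, vecNormSq, Complex.normSq_eq_conj_mul_self]

lemma vecNormSq_star {n : ℕ} (v : Fin n → ℂ) : vecNormSq (star v) = vecNormSq v := by
  simp [vecNormSq]

lemma star_dotProduct_one_sub_mulVec {n : ℕ} {Z : Matrix (Fin n) (Fin n) ℂ} (hZ : Zᵀ = Z)
    (v : Fin n → ℂ) : star v ⬝ᵥ ((1 - Z * Zᴴ) *ᵥ v) =
      ((vecNormSq v - vecNormSq (Z *ᵥ star v) : ℝ) : ℂ) := by
  have h : Zᴴ *ᵥ v = star (Z *ᵥ star v) := by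
    have hT : Zᴴᵀ = Zᴴ := Matrix.ext fun i j => congrArg star (congrFun₂ hZ j i)
    rw [star_mulVec, star_star, ← mulVec_transpose, hT]
  rw [sub_mulVec, dotProduct_sub, one_mulVec, ← mulVec_mulVec, dotProduct_mulVec,
    star_dotProduct_self, ← star_star (star v ᵥ* Z), star_vecMul, star_star, h,
    star_dotProduct_self, vecNormSq_star]
  push_cast
  rfl

lemma mem_OmegaIII_iff {n : ℕ} {Z : Matrix (Fin n) (Fin n) ℂ} :
    Z ∈ OmegaIII n ↔ Zᵀ = Z ∧ ∀ v, v ≠ 0 → vecNormSq (Z *ᵥ v) < vecNormSq v := by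
  refine and_congr_right fun hZ => ?_
  have hH : (1 - Z * Zᴴ).IsHermitian := isHermitian_one.sub (isHermitian_mul_conjTranspose_self Z)
  rw [posDef_iff_dotProduct_mulVec]
  refine ⟨fun h v hv => ?_, fun h => ⟨hH, fun {v} hv => ?_⟩⟩
  · have := h.2 (x := star v) (by simpa using hv)
    rw [star_dotProduct_one_sub_mulVec hZ, star_star, vecNormSq_star] at this
    have := Complex.zero_lt_real.1 this
    linarith
  · rw [star_dotProduct_one_sub_mulVec hZ]
    refine Complex.zero_lt_real.2 ?_
    have := h (star v) (by simpa using hv)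
    rw [vecNormSq_star] at this
    linarith

lemma vecNormSq_pos {n : ℕ} {v : Fin n → ℂ} (hv : v ≠ 0) : 0 < vecNormSq v := by
  obtain ⟨i, hi⟩ := Function.ne_iff.1 hv
  exact Finset.sum_pos' (fun _ _ => Complex.normSq_nonneg _)
    ⟨i, Finset.mem_univ i, Complex.normSq_pos.2 hi⟩

lemma vecNormSq_single {n : ℕ} (j : Fin n) : vecNormSq (Pi.single j (1 : ℂ)) = 1 := by
  rw [vecNormSq, Finset.sum_eq_single j] <;> simp +contextual

lemma normSq_entry_le {n : ℕ} {Z : Matrix (Fin n) (Fin n) ℂ}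
    (h : ∀ v, vecNormSq (Z *ᵥ v) ≤ vecNormSq v) (i j : Fin n) : Complex.normSq (Z i j) ≤ 1 := by
  have := h (Pi.single j 1)
  rw [vecNormSq_single, mulVec_single_one] at this
  exact (Finset.single_le_sum (f := fun i => Complex.normSq (Z.col j i))
    (fun _ _ => Complex.normSq_nonneg _) (Finset.mem_univ i)).trans this

lemma vecNormSq_mulVec_le_of_mem {n : ℕ} {Z : Matrix (Fin n) (Fin n) ℂ} (hZ : Z ∈ OmegaIII n)
    (v : Fin n → ℂ) : vecNormSq (Z *ᵥ v) ≤ vecNormSq v := by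
  obtain rfl | hv := eq_or_ne v 0
  · simp
  · exact ((mem_OmegaIII_iff.1 hZ).2 v hv).le

lemma continuous_vecNormSq_mulVec {n : ℕ} (v : Fin n → ℂ) :
    Continuous fun Z : Matrix (Fin n) (Fin n) ℂ => vecNormSq (Z *ᵥ v) := by
  unfold vecNormSq
  refine continuous_finsetSum _ fun i _ => Complex.continuous_normSq.comp ?_
  exact (continuous_apply i).comp (Continuous.matrix_mulVec continuous_id continuous_const)

/-- The closed unit ball of symmetric matrices for the operator norm. -/
def symmetricContractions (n : ℕ) : Set (Matrix (Fin n) (Fin n) ℂ) :=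
  {Z | Zᵀ = Z ∧ ∀ v, vecNormSq (Z *ᵥ v) ≤ vecNormSq v}

lemma isCompact_symmetricContractions (n : ℕ) : IsCompact (symmetricContractions n) := by
  have hc : IsCompact (Set.univ.pi fun _ : Fin n => Set.univ.pi fun _ : Fin n =>
      Metric.closedBall (0 : ℂ) 1) :=
    isCompact_univ_pi fun _ => isCompact_univ_pi fun _ => isCompact_closedBall _ _
  refine IsCompact.of_isClosed_subset (X := Fin n → Fin n → ℂ) hc ?_ ?_
  · have h : symmetricContractions n = {Z | Zᵀ = Z} ∩
        ⋂ v, {Z : Matrix (Fin n) (Fin n) ℂ | vecNormSq (Z *ᵥ v) ≤ vecNormSq v} := by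
      ext Z
      simp [symmetricContractions]
    rw [h]
    refine IsClosed.inter (isClosed_eq (X := Matrix (Fin n) (Fin n) ℂ)
      (Continuous.matrix_transpose continuous_id) continuous_id) ?_
    exact isClosed_iInter fun v => isClosed_le (continuous_vecNormSq_mulVec v) continuous_const
  · intro Z hZ i _ j _
    have := normSq_entry_le hZ.2 i j
    rw [Complex.normSq_eq_norm_sq] at this
    simpa using (sq_le_one_iff₀ (norm_nonneg _)).1 this

lemma normSq_real_combination_le {a b : ℝ} (h : a ^ 2 + b ^ 2 = 1) (z w : ℂ) :
    Complex.normSq (a * z + b * w) ≤ Complex.normSq z + Complex.normSq w := by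
  have key : Complex.normSq z + Complex.normSq w - Complex.normSq (a * z + b * w) =
      Complex.normSq (b * z - a * w) := by
    simp only [Complex.normSq_apply, Complex.add_re, Complex.add_im, Complex.mul_re,
      Complex.mul_im, Complex.sub_re, Complex.sub_im, Complex.ofReal_re, Complex.ofReal_im]
    linear_combination (-(z.re * z.re + z.im * z.im + w.re * w.re + w.im * w.im)) * h
  linarith [Complex.normSq_nonneg (b * z - a * w)]

/-- The square roots occurring in `ht`, with `c = 1 / √(2 - t)`. -/
lemma ht_coefficients {t : ℝ} (ht01 : t ∈ Set.Icc (0 : ℝ) 1) : ∃ r s u c : ℝ,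
    0 < c ∧ 0 ≤ s ∧ u = √t ∧ s ^ 2 = 1 - t ∧ s ^ 2 + u ^ 2 = 1 ∧ c ^ 2 + (s * c) ^ 2 = 1 ∧
    r * c = 1 ∧
    ∀ Z : Matrix (Fin 2) (Fin 2) ℂ, ht t Z =
      !![Z 0 0 ^ 2, r * Z 0 0 * Z 0 1, s * Z 0 1 ^ 2, u * Z 0 1;
        r * Z 0 0 * Z 0 1, 2 * (s * c) ^ 2 * Z 0 0 * Z 1 1 + Z 0 1 ^ 2,
          2 * (s * c) * Z 0 1 * Z 1 1, u * c * Z 1 1;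
        s * Z 0 1 ^ 2, 2 * (s * c) * Z 0 1 * Z 1 1, Z 1 1 ^ 2, 0;
        u * Z 0 1, u * c * Z 1 1, 0, 0] := by
  obtain ⟨h0, h1⟩ := ht01
  have hr : 0 < √(2 - t) := Real.sqrt_pos.2 (by linarith)
  have hr2 : √(2 - t) ^ 2 = 2 - t := Real.sq_sqrt (by linarith)
  have hs2 : √(1 - t) ^ 2 = 1 - t := Real.sq_sqrt (by linarith)
  have hu2 : √t ^ 2 = t := Real.sq_sqrt h0
  refine ⟨√(2 - t), √(1 - t), √t, (√(2 - t))⁻¹, inv_pos.2 hr, Real.sqrt_nonneg _, rfl, hs2,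
    by linarith, ?_, mul_inv_cancel₀ hr.ne', fun Z => ?_⟩
  · field_simp
    linarith
  · have e1 : √((1 - t) / (2 - t)) = √(1 - t) * (√(2 - t))⁻¹ := by
      rw [Real.sqrt_div (by linarith), div_eq_mul_inv]
    have e2 : √(t / (2 - t)) = √t * (√(2 - t))⁻¹ := by
      rw [Real.sqrt_div h0, div_eq_mul_inv]
    have e3 : 2 * (1 - t) / (2 - t) = 2 * (√(1 - t) * (√(2 - t))⁻¹) ^ 2 := by
      rw [mul_pow, inv_pow, hr2, hs2, div_eq_mul_inv, mul_assoc]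
    rw [ht, e1, e2, e3]
    push_cast
    rfl

lemma vecNormSq_two (v : Fin 2 → ℂ) :
    vecNormSq v = Complex.normSq (v 0) + Complex.normSq (v 1) := by
  simp [vecNormSq, Fin.sum_univ_two]

lemma vecNormSq_four (v : Fin 4 → ℂ) :
    vecNormSq v = Complex.normSq (v 0) + Complex.normSq (v 1) + Complex.normSq (v 2) +
      Complex.normSq (v 3) := by
  simp [vecNormSq, Fin.sum_univ_four]

lemma mulVec_two {Z : Matrix (Fin 2) (Fin 2) ℂ} (hZ : Zᵀ = Z) (v : Fin 2 → ℂ) :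
    Z *ᵥ v = ![Z 0 0 * v 0 + Z 0 1 * v 1, Z 0 1 * v 0 + Z 1 1 * v 1] := by
  have h : Z 1 0 = Z 0 1 := congrFun₂ hZ 0 1
  ext i
  fin_cases i <;> simp [mulVec, dotProduct, Fin.sum_univ_two, h]

lemma ht_mulVec {r s u c : ℝ} (hcg : c ^ 2 + (s * c) ^ 2 = 1) (hrc : r * c = 1)
    (a b d : ℂ) (v : Fin 4 → ℂ) :
    !![a ^ 2, r * a * b, s * b ^ 2, u * b;
      r * a * b, 2 * (s * c) ^ 2 * a * d + b ^ 2, 2 * (s * c) * b * d, u * c * d;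
      s * b ^ 2, 2 * (s * c) * b * d, d ^ 2, 0;
      u * b, u * c * d, 0, 0] *ᵥ v =
    let p₁ := a * v 0 + b * (c * v 1)
    let p₂ := b * v 0 + d * (c * v 1)
    let q₁ := a * ((s * c : ℝ) * v 1) + b * v 2
    let q₂ := b * ((s * c : ℝ) * v 1) + d * v 2
    let m := (s : ℂ) * q₁ + u * v 3
    ![a * p₁ + b * m, c * (b * p₁ + d * m) + (s * c : ℝ) * (a * (s * p₂) + b * q₂),
      b * (s * p₂) + d * q₂, u * p₂] := by
  have hgc : (c : ℂ) ^ 2 + (s * c) ^ 2 = 1 := by exact_mod_cast hcg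
  have hrc' : (r : ℂ) * c = 1 := by exact_mod_cast hrc
  have hr : (r : ℂ) = c + s * (s * c) := by
    linear_combination (-(r : ℂ)) * hgc + (c + s * s * c) * hrc'
  rw [hr]
  ext i
  fin_cases i
  · simp [mulVec, dotProduct, Fin.sum_univ_four]
    ring
  · simp [mulVec, dotProduct, Fin.sum_univ_four]
    linear_combination -b ^ 2 * v 1 * hgc
  · simp [mulVec, dotProduct, Fin.sum_univ_four]
    ring
  · simp [mulVec, dotProduct, Fin.sum_univ_four]
    ring

lemma normSq_ofReal_mul (a : ℝ) (z : ℂ) :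
    Complex.normSq (a * z) = a ^ 2 * Complex.normSq z := by
  rw [Complex.normSq_mul, Complex.normSq_ofReal, sq]

lemma mapsTo_ht {t : ℝ} (ht01 : t ∈ Set.Icc (0 : ℝ) 1) :
    Set.MapsTo (ht t) (OmegaIII 2) (OmegaIII 4) := by
  intro Z hZ
  obtain ⟨r, s, u, c, hc, hs, -, -, hsu, hcg, hrc, hH⟩ := ht_coefficients ht01
  have hle := vecNormSq_mulVec_le_of_mem hZ
  rw [mem_OmegaIII_iff] at hZ ⊢
  obtain ⟨hZT, hlt⟩ := hZ
  refine ⟨by rw [hH]; ext i j; fin_cases i <;> fin_cases j <;> rfl, fun v hv => ?_⟩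
  rw [hH, ht_mulVec hcg hrc, vecNormSq_four, vecNormSq_four]
  simp only [mulVec_two hZT, vecNormSq_two] at hle hlt
  have hle' : ∀ x y, Complex.normSq (Z 0 0 * x + Z 0 1 * y) +
      Complex.normSq (Z 0 1 * x + Z 1 1 * y) ≤
      Complex.normSq x + Complex.normSq y := fun x y => by simpa using hle ![x, y]
  have hlt' : ∀ x y, (x ≠ 0 ∨ y ≠ 0) →
      Complex.normSq (Z 0 0 * x + Z 0 1 * y) + Complex.normSq (Z 0 1 * x + Z 1 1 * y) <
      Complex.normSq x + Complex.normSq y := fun x y hxy => by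
    have hne : ![x, y] ≠ 0 := by
      rintro h
      have h0 := congrFun h 0
      have h1 := congrFun h 1
      simp at h0 h1
      tauto
    simpa using hlt ![x, y] hne
  clear hle hlt
  dsimp only [cons_val]
  set a := Z 0 0
  set b := Z 0 1
  set d := Z 1 1
  set p₁ := a * v 0 + b * (c * v 1) with hp₁
  set p₂ := b * v 0 + d * (c * v 1) with hp₂
  set q₁ := a * ((s * c : ℝ) * v 1) + b * v 2 with hq₁
  set q₂ := b * ((s * c : ℝ) * v 1) + d * v 2 with hq₂
  set m := (s : ℂ) * q₁ + u * v 3 with hm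
  have e1 := normSq_real_combination_le hcg (b * p₁ + d * m) (a * (s * p₂) + b * q₂)
  have e2 := hle' (s * p₂) q₂
  have e3 := hle' p₁ m
  have e4 := normSq_real_combination_le hsu q₁ (v 3)
  have e5 := hle' (v 0) (c * v 1)
  have e6 := hle' ((s * c : ℝ) * v 1) (v 2)
  have e7 : s ^ 2 * Complex.normSq p₂ + u ^ 2 * Complex.normSq p₂ = Complex.normSq p₂ := by
    rw [← add_mul, hsu, one_mul]
  have e8 : c ^ 2 * Complex.normSq (v 1) + (s * c) ^ 2 * Complex.normSq (v 1) =
      Complex.normSq (v 1) := by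
    rw [← add_mul, hcg, one_mul]
  rw [← hp₁, ← hp₂] at e5
  rw [← hq₁, ← hq₂] at e6
  rw [← hm] at e4
  simp only [normSq_ofReal_mul] at e2 e5 e6 ⊢
  by_cases h01 : v 0 ≠ 0 ∨ v 1 ≠ 0
  · have := hlt' (v 0) (c * v 1)
      (h01.imp_right fun h => mul_ne_zero (Complex.ofReal_ne_zero.2 hc.ne') h)
    rw [← hp₁, ← hp₂, normSq_ofReal_mul] at this
    linarith
  push Not at h01
  by_cases h2 : v 2 ≠ 0
  · have := hlt' ((s * c : ℝ) * v 1) (v 2) (Or.inr h2)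
    rw [← hq₁, ← hq₂, normSq_ofReal_mul] at this
    linarith
  push Not at h2
  by_cases hm0 : m ≠ 0
  · have := hlt' p₁ m (Or.inr hm0)
    linarith
  push Not at hm0
  have hv3 : v 3 ≠ 0 := by
    rintro h3
    refine hv (funext fun i => ?_)
    fin_cases i
    exacts [h01.1, h01.2, h2, h3]
  have h3 := Complex.normSq_pos.2 hv3
  have hp₁0 : p₁ = 0 := by rw [hp₁, h01.1, h01.2]; ring
  have hp₂0 : p₂ = 0 := by rw [hp₂, h01.1, h01.2]; ring
  have hq₂0 : q₂ = 0 := by rw [hq₂, h01.2, h2]; ring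
  rw [hm0, hp₁0, hp₂0, hq₂0]
  simp only [mul_zero, add_zero, map_zero, zero_add, h01.1, h01.2, h2]
  exact h3

lemma exists_vecNormSq_ht_mulVec_eq {t : ℝ} (ht01 : t ∈ Set.Icc (0 : ℝ) 1)
    {Z : Matrix (Fin 2) (Fin 2) ℂ} (hZ : Zᵀ = Z) {x : Fin 2 → ℂ} (hx : x ≠ 0)
    (h : vecNormSq (Z *ᵥ x) = vecNormSq x) :
    ∃ v, v ≠ 0 ∧ vecNormSq (ht t Z *ᵥ v) = vecNormSq v := by
  obtain ⟨r, s, u, c, hc, hs, -, -, hsu, hcg, hrc, hH⟩ := ht_coefficients ht01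
  rw [mulVec_two hZ, vecNormSq_two, vecNormSq_two] at h
  dsimp only [cons_val] at h
  rw [hH]
  simp only [ht_mulVec hcg hrc]
  set a := Z 0 0
  set b := Z 0 1
  set d := Z 1 1
  have hc' : (c : ℂ) ≠ 0 := Complex.ofReal_ne_zero.2 hc.ne'
  by_cases hdeg : x 0 = 0 ∧ s = 0 ∧ b = 0
  · obtain ⟨hx0, hs0, hb0⟩ := hdeg
    have hx1 : x 1 ≠ 0 := fun hx1 => hx (funext fun i => by fin_cases i; exacts [hx0, hx1])
    simp only [hx0, hb0, mul_zero, zero_mul, zero_add, map_zero, Complex.normSq_mul] at h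
    have hd : Complex.normSq d = 1 := by
      have := Complex.normSq_pos.2 hx1
      exact mul_right_cancel₀ this.ne' (by rw [h, one_mul])
    refine ⟨![0, 0, 1, 0], fun h0 => by simpa using congrFun h0 2, ?_⟩
    simp [vecNormSq_four, hs0, hb0, hd]
  set y₁ := a * x 0 + b * x 1 with hy₁
  set y₂ := b * x 0 + d * x 1 with hy₂
  refine ⟨![c * x 0 ^ 2, x 0 * x 1, (s * c : ℝ) * x 1 ^ 2, (u * c : ℝ) * (x 1 * y₁)],
    fun h0 => hdeg ?_, ?_⟩
  · have hx0 : x 0 = 0 := by simpa [hc'] using congrFun h0 0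
    have hx1 : x 1 ≠ 0 := fun hx1 => hx (funext fun i => by fin_cases i; exacts [hx0, hx1])
    have hs0 : s = 0 := by simpa [hc.ne', hx1] using congrFun h0 2
    have hu : u ≠ 0 := by rintro rfl; simp [hs0] at hsu
    refine ⟨hx0, hs0, ?_⟩
    simpa [hu, hc.ne', hx1, hy₁, hx0] using congrFun h0 3
  · have hgc : (c : ℂ) ^ 2 + (s * c) ^ 2 = 1 := by exact_mod_cast hcg
    have hsu' : (s : ℂ) ^ 2 + u ^ 2 = 1 := by exact_mod_cast hsu
    have key : vecNormSq ![c * y₁ ^ 2, y₁ * y₂, (s * c : ℝ) * y₂ ^ 2,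
        (u * c : ℝ) * (x 0 * y₂)] = vecNormSq ![c * x 0 ^ 2, x 0 * x 1,
        (s * c : ℝ) * x 1 ^ 2, (u * c : ℝ) * (x 1 * y₁)] := by
      simp only [vecNormSq_four, cons_val, normSq_ofReal_mul]
      simp only [Complex.normSq_mul, map_pow]
      generalize Complex.normSq y₁ = A at *
      generalize Complex.normSq y₂ = B at *
      generalize Complex.normSq (x 0) = X at *
      generalize Complex.normSq (x 1) = Y at *
      linear_combination (X * Y - A * B) * hcg - c ^ 2 * (Y * A - X * B) * hsu +
        c ^ 2 * ((X + Y) * s ^ 2 + A + s ^ 2 * B + (1 - s ^ 2) * X) * h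
    rw [← key]
    congr 1
    ext i
    fin_cases i
    · simp
      linear_combination b * c * x 1 * y₁ * hsu'
    · simp
      linear_combination y₁ * y₂ * hgc + c ^ 2 * d * x 1 * y₁ * hsu'
    · simp
      ring
    · simp
      ring

lemma differentiable_ht (t : ℝ) : Differentiable ℂ (ht t) := by
  have he : ∀ i j : Fin 2, Differentiable ℂ fun Z : Matrix (Fin 2) (Fin 2) ℂ => Z i j :=
    fun i j => ((ContinuousLinearMap.proj (R := ℂ) (φ := fun _ : Fin 2 => ℂ) j).comp
      (ContinuousLinearMap.proj (R := ℂ) (φ := fun _ : Fin 2 => Fin 2 → ℂ) i)).differentiable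
  have h00 := he 0 0
  have h01 := he 0 1
  have h11 := he 1 1
  refine differentiable_pi.2 fun i => differentiable_pi.2 fun j => ?_
  fin_cases i <;> fin_cases j
  exacts [h00.pow 2, (h00.const_mul _).mul h01, (h01.pow 2).const_mul _, h01.const_mul _,
    (h00.const_mul _).mul h01, ((h00.const_mul _).mul h11).add (h01.pow 2),
    (h01.const_mul _).mul h11, h11.const_mul _,
    (h01.pow 2).const_mul _, (h01.const_mul _).mul h11, h11.pow 2, differentiable_const _,
    h01.const_mul _, h11.const_mul _, differentiable_const _, differentiable_const _]

lemma exists_vecNormSq_eq_of_notMem {n : ℕ} {Z : Matrix (Fin n) (Fin n) ℂ}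
    (hZ : Z ∈ symmetricContractions n) (hZ' : Z ∉ OmegaIII n) :
    ∃ v, v ≠ 0 ∧ vecNormSq (Z *ᵥ v) = vecNormSq v := by
  by_contra! h
  exact hZ' (mem_OmegaIII_iff.2 ⟨hZ.1, fun v hv => lt_of_le_of_ne (hZ.2 v) (h v hv)⟩)

lemma isProperOn_ht {t : ℝ} (ht01 : t ∈ Set.Icc (0 : ℝ) 1) :
    IsProperOn (ht t) (OmegaIII 2) (OmegaIII 4) := by
  intro K hK hKc
  have h : OmegaIII 2 ∩ ht t ⁻¹' K = symmetricContractions 2 ∩ ht t ⁻¹' K := by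
    ext Z
    refine and_congr_left fun hZK => ⟨fun hZ => ⟨hZ.1, vecNormSq_mulVec_le_of_mem hZ⟩,
      fun hZ => by_contra fun hZ' => ?_⟩
    obtain ⟨x, hx, hxe⟩ := exists_vecNormSq_eq_of_notMem hZ hZ'
    obtain ⟨v, hv, hve⟩ := exists_vecNormSq_ht_mulVec_eq ht01 hZ.1 hx hxe
    exact ((mem_OmegaIII_iff.1 (hK hZK)).2 v hv).ne hve
  rw [h]
  exact (isCompact_symmetricContractions 2).inter_right
    (hKc.isClosed.preimage (differentiable_ht t).continuous)

lemma isAutomorphismOf_id {E : Type*} [NormedAddCommGroup E] [NormedSpace ℂ E] (Ω : Set E) :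
    IsAutomorphismOf Ω id :=
  ⟨Set.mapsTo_id Ω, differentiableOn_id, id, Set.mapsTo_id Ω, differentiableOn_id,
    fun _ _ => rfl, fun _ _ => rfl⟩

/-- Equivalence of maps between domains up to automorphisms of source and target is symmetric. -/
lemma exists_isAutomorphismOf_symm {E F : Type*} [NormedAddCommGroup E] [NormedSpace ℂ E]
    [NormedAddCommGroup F] [NormedSpace ℂ F] {Ω₁ : Set E} {Ω₂ : Set F} {f g : E → F}
    (hg : Set.MapsTo g Ω₁ Ω₂)
    (h : ∃ τ σ, IsAutomorphismOf Ω₁ τ ∧ IsAutomorphismOf Ω₂ σ ∧ ∀ z ∈ Ω₁, f z = σ (g (τ z))) :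
    ∃ τ σ, IsAutomorphismOf Ω₁ τ ∧ IsAutomorphismOf Ω₂ σ ∧ ∀ z ∈ Ω₁, g z = σ (f (τ z)) := by
  obtain ⟨τ, σ, ⟨hτ, hτd, τ', hτ', hτd', hl, hr⟩, ⟨hσ, hσd, σ', hσ', hσd', hl', hr'⟩, h⟩ := h
  refine ⟨τ', σ', ⟨hτ', hτd', τ, hτ, hτd, hr, hl⟩, ⟨hσ', hσd', σ, hσ, hσd, hr', hl'⟩,
    fun z hz => ?_⟩
  rw [h _ (hτ' hz), hr z hz, hl' _ (hg hz)]

open Filter Topology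

lemma hasDerivAt_comp_of_eventually_mem {E F : Type*} [NormedAddCommGroup E] [NormedSpace ℂ E]
    [NormedAddCommGroup F] [NormedSpace ℂ F] {Ω : Set E} {f : E → F}
    (hf : DifferentiableOn ℂ f Ω) {γ : ℂ → E} {D : E} (hγ : HasDerivAt γ D 0)
    (hmem : ∀ᶠ ζ in 𝓝 0, γ ζ ∈ Ω) :
    HasDerivAt (fun ζ => f (γ ζ)) (fderivWithin ℂ f Ω (γ 0) D) 0 :=
  (((hf _ hmem.self_of_nhds).hasFDerivWithinAt.comp_hasDerivWithinAt 0
    hγ.hasDerivWithinAt fun _ h => h).hasDerivAt (s := {ζ | γ ζ ∈ Ω}) hmem)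

lemma HasDerivAt.matrix_entry {m n : ℕ} {γ : ℂ → Matrix (Fin m) (Fin n) ℂ}
    {D : Matrix (Fin m) (Fin n) ℂ} {z : ℂ} (h : HasDerivAt γ D z) (i : Fin m) (j : Fin n) :
    HasDerivAt (fun ζ => γ ζ i j) (D i j) z :=
  hasDerivAt_pi.1 (hasDerivAt_pi.1 h i) j

lemma hasDerivAt_matrix {m n : ℕ} {γ : ℂ → Matrix (Fin m) (Fin n) ℂ}
    {D : Matrix (Fin m) (Fin n) ℂ} {z : ℂ}
    (h : ∀ i j, HasDerivAt (fun ζ => γ ζ i j) (D i j) z) : HasDerivAt γ D z :=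
  hasDerivAt_pi.2 fun i => hasDerivAt_pi.2 (h i)

lemma hasDerivAt_smul_matrix {n : ℕ} (X : Matrix (Fin n) (Fin n) ℂ) :
    HasDerivAt (fun ζ : ℂ => ζ • X) X 0 := by
  have h := (hasDerivAt_id (0 : ℂ)).smul_const X
  rw [one_smul] at h
  exact h

lemma zero_mem_OmegaIII (n : ℕ) : (0 : Matrix (Fin n) (Fin n) ℂ) ∈ OmegaIII n :=
  mem_OmegaIII_iff.2 ⟨transpose_zero, fun v hv => by
    simpa [vecNormSq] using vecNormSq_pos hv⟩

lemma smul_mem_OmegaIII {n : ℕ} {X : Matrix (Fin n) (Fin n) ℂ}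
    (hX : X ∈ symmetricContractions n) {ζ : ℂ} (hζ : ζ ∈ Metric.ball (0 : ℂ) 1) :
    ζ • X ∈ OmegaIII n := by
  refine mem_OmegaIII_iff.2 ⟨by rw [transpose_smul, hX.1], fun v hv => ?_⟩
  have h1 : vecNormSq ((ζ • X) *ᵥ v) = Complex.normSq ζ * vecNormSq (X *ᵥ v) := by
    simp [vecNormSq, smul_mulVec, Finset.mul_sum]
  have h2 : Complex.normSq ζ < 1 := by
    rw [mem_ball_zero_iff] at hζ
    rw [Complex.normSq_eq_norm_sq]
    nlinarith [norm_nonneg ζ]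
  rw [h1]
  nlinarith [hX.2 v, vecNormSq_pos hv, Complex.normSq_nonneg ζ]

lemma ht_zero (t : ℝ) : ht t 0 = 0 := by
  ext i j
  fin_cases i <;> fin_cases j <;> simp [ht]

lemma hasDerivAt_norm_le_one {f : ℂ → ℂ} {d : ℂ} {R : ℝ}
    (hf : DifferentiableOn ℂ f (Metric.ball 0 1)) (h0 : f 0 = 0)
    (hR : ∀ ζ ∈ Metric.ball (0 : ℂ) 1, ‖f ζ‖ ≤ R) (hd : HasDerivAt f d 0) : ‖d‖ ≤ R := by
  have := Complex.norm_deriv_le_div_of_mapsTo_ball (R₂ := R) hf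
    (fun ζ hζ => by simpa [h0] using hR ζ hζ) one_pos
  rwa [hd.deriv, div_one] at this

/-- If the derivative of `ht t` along a curve `γ` of symmetric matrices vanishes in a nonzero
direction, then the base point is the origin, provided `t < 1`. -/
lemma eq_zero_of_hasDerivAt_ht_zero {t : ℝ} (ht01 : t ∈ Set.Icc (0 : ℝ) 1) (ht1 : t < 1)
    {γ : ℂ → Matrix (Fin 2) (Fin 2) ℂ} {D : Matrix (Fin 2) (Fin 2) ℂ} (hγ : HasDerivAt γ D 0)
    (hγ0 : (γ 0)ᵀ = γ 0) (hDT : Dᵀ = D) (hD : D ≠ 0)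
    (h : HasDerivAt (fun ζ => ht t (γ ζ)) 0 0) : γ 0 = 0 := by
  obtain ⟨r, s, u, c, hc, hs, -, hst, hsu, hcg, hrc, hH⟩ := ht_coefficients ht01
  have hs0 : (s : ℂ) ≠ 0 := Complex.ofReal_ne_zero.2 (by rintro rfl; norm_num at hst; linarith)
  have hc0 : (c : ℂ) ≠ 0 := Complex.ofReal_ne_zero.2 hc.ne'
  have hr0 : (r : ℂ) ≠ 0 := Complex.ofReal_ne_zero.2 (left_ne_zero_of_mul_eq_one hrc)
  simp only [hH] at h
  have h1 := hγ.matrix_entry 0 0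
  have h2 := hγ.matrix_entry 0 1
  have h3 := hγ.matrix_entry 1 1
  have e00 : 2 * γ 0 0 0 * D 0 0 = 0 := by
    simpa using ((h.matrix_entry 0 0).unique (h1.pow 2)).symm
  have e01 : r * D 0 0 * γ 0 0 1 + r * γ 0 0 0 * D 0 1 = 0 :=
    ((h.matrix_entry 0 1).unique ((h1.const_mul (r : ℂ)).mul h2)).symm
  have e02 : (s : ℂ) * (2 * γ 0 0 1 * D 0 1) = 0 := by
    simpa using ((h.matrix_entry 0 2).unique ((h2.pow 2).const_mul (s : ℂ))).symm
  have e11 : 2 * (s * c : ℂ) ^ 2 * D 0 0 * γ 0 1 1 + 2 * (s * c : ℂ) ^ 2 * γ 0 0 0 * D 1 1 +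
      2 * γ 0 0 1 * D 0 1 = 0 := by
    simpa using ((h.matrix_entry 1 1).unique
      (((h1.const_mul (2 * (s * c) ^ 2 : ℂ)).mul h3).add (h2.pow 2))).symm
  have e12 : 2 * (s * c : ℂ) * D 0 1 * γ 0 1 1 + 2 * (s * c : ℂ) * γ 0 0 1 * D 1 1 = 0 :=
    ((h.matrix_entry 1 2).unique ((h2.const_mul (2 * (s * c) : ℂ)).mul h3)).symm
  have e22 : 2 * γ 0 1 1 * D 1 1 = 0 := by
    simpa using ((h.matrix_entry 2 2).unique (h3.pow 2)).symm
  have hg10 : γ 0 1 0 = γ 0 0 1 := congrFun₂ hγ0 0 1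
  have hD10 : D 1 0 = D 0 1 := congrFun₂ hDT 0 1
  have hD' : ¬ (D 0 0 = 0 ∧ D 0 1 = 0 ∧ D 1 1 = 0) := by
    rintro ⟨h00, h01, h11⟩
    refine hD (Matrix.ext fun i j => ?_)
    fin_cases i <;> fin_cases j
    exacts [h00, h01, hD10.trans h01, h11]
  have hw : γ 0 0 0 = 0 ∧ γ 0 0 1 = 0 ∧ γ 0 1 1 = 0 := by
    generalize γ 0 0 0 = w₁ at *
    generalize γ 0 0 1 = w₂ at *
    generalize γ 0 1 1 = w₃ at *
    generalize D 0 0 = d₁ at *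
    generalize D 0 1 = d₂ at *
    generalize D 1 1 = d₃ at *
    have hw₁ : w₁ = 0 := by
      by_contra hw
      have hd₁ : d₁ = 0 := by simpa [hw] using e00
      have hd₂ : d₂ = 0 := by simpa [hw, hd₁, hr0] using e01
      exact hD' ⟨hd₁, hd₂, by simpa [hw, hd₁, hd₂, hs0, hc0] using e11⟩
    have hw₂ : w₂ = 0 := by
      by_contra hw
      have hd₁ : d₁ = 0 := by simpa [hw, hw₁, hr0] using e01
      have hd₂ : d₂ = 0 := by simpa [hw, hs0] using e02
      exact hD' ⟨hd₁, hd₂, by simpa [hw, hd₂, hs0, hc0] using e12⟩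
    refine ⟨hw₁, hw₂, by_contra fun hw => hD' ⟨?_, ?_, ?_⟩⟩
    · simpa [hw, hw₁, hw₂, hs0, hc0] using e11
    · simpa [hw, hw₂, hs0, hc0] using e12
    · simpa [hw] using e22
  refine Matrix.ext fun i j => ?_
  fin_cases i <;> fin_cases j
  exacts [hw.1, hw.2.1, hg10.trans hw.2.1, hw.2.2]

lemma transpose_eq_of_hasDerivAt {n : ℕ} {γ : ℂ → Matrix (Fin n) (Fin n) ℂ}
    {D : Matrix (Fin n) (Fin n) ℂ} (hγ : HasDerivAt γ D 0)
    (hT : ∀ᶠ ζ in 𝓝 0, (γ ζ)ᵀ = γ ζ) : Dᵀ = D :=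
  Matrix.ext fun i j => (hγ.matrix_entry j i).unique ((hγ.matrix_entry i j).congr_of_eventuallyEq
    (hT.mono fun _ h => congrFun₂ h i j))

lemma eventually_smul_mem_OmegaIII {n : ℕ} {X : Matrix (Fin n) (Fin n) ℂ}
    (hX : X ∈ symmetricContractions n) : ∀ᶠ ζ : ℂ in 𝓝 0, ζ • X ∈ OmegaIII n := by
  filter_upwards [Metric.ball_mem_nhds (0 : ℂ) one_pos] with ζ hζ using smul_mem_OmegaIII hX hζ

lemma diag_mem_symmetricContractions :
    !![(1 : ℂ), 0; 0, 0] ∈ symmetricContractions 2 := by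
  have hT : !![(1 : ℂ), 0; 0, 0]ᵀ = !![(1 : ℂ), 0; 0, 0] := by
    ext i j
    fin_cases i <;> fin_cases j <;> rfl
  refine ⟨hT, fun v => ?_⟩
  rw [mulVec_two hT, vecNormSq_two, vecNormSq_two]
  simpa using Complex.normSq_nonneg _

lemma antidiag_mem_symmetricContractions :
    !![(0 : ℂ), 1; 1, 0] ∈ symmetricContractions 2 := by
  have hT : !![(0 : ℂ), 1; 1, 0]ᵀ = !![(0 : ℂ), 1; 1, 0] := by
    ext i j
    fin_cases i <;> fin_cases j <;> rfl
  refine ⟨hT, fun v => ?_⟩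
  rw [mulVec_two hT, vecNormSq_two, vecNormSq_two]
  simp [add_comm]

lemma hasDerivAt_ht_smul_diag (t : ℝ) :
    HasDerivAt (fun ζ : ℂ => ht t (ζ • !![(1 : ℂ), 0; 0, 0])) 0 0 := by
  have h : (fun ζ : ℂ => ht t (ζ • !![(1 : ℂ), 0; 0, 0])) =
      fun ζ => ζ ^ 2 • Matrix.single 0 0 (1 : ℂ) := by
    ext ζ i j
    fin_cases i <;> fin_cases j <;> simp [ht, Matrix.single]
  rw [h]
  have h2 := ((hasDerivAt_id (0 : ℂ)).pow 2).smul_const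
    (Matrix.single (0 : Fin 4) (0 : Fin 4) (1 : ℂ))
  have h3 : ((2 : ℕ) * id (0 : ℂ) ^ (2 - 1) * 1) • Matrix.single (0 : Fin 4) (0 : Fin 4) (1 : ℂ)
      = 0 := by simp
  rw [h3] at h2
  exact h2

lemma automorphism_zero_eq_zero {t t' : ℝ} (ht01' : t' ∈ Set.Icc (0 : ℝ) 1) (ht1 : t' < 1)
    {τ : Matrix (Fin 2) (Fin 2) ℂ → Matrix (Fin 2) (Fin 2) ℂ}
    {σ : Matrix (Fin 4) (Fin 4) ℂ → Matrix (Fin 4) (Fin 4) ℂ}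
    (hτ : IsAutomorphismOf (OmegaIII 2) τ) (hσ : IsAutomorphismOf (OmegaIII 4) σ)
    (ht01 : t ∈ Set.Icc (0 : ℝ) 1)
    (h : ∀ Z ∈ OmegaIII 2, ht t Z = σ (ht t' (τ Z))) : τ 0 = 0 := by
  obtain ⟨hτ, hτd, τ', hτ', hτd', hl, -⟩ := hτ
  obtain ⟨-, -, σ', hσ', hσd', hl', -⟩ := hσ
  set X : Matrix (Fin 2) (Fin 2) ℂ := !![1, 0; 0, 0] with hX
  have hmem : ∀ᶠ ζ : ℂ in 𝓝 0, ζ • X ∈ OmegaIII 2 :=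
    eventually_smul_mem_OmegaIII diag_mem_symmetricContractions
  have hγ := hasDerivAt_comp_of_eventually_mem hτd (hasDerivAt_smul_matrix X) hmem
  have hγmem : ∀ᶠ ζ : ℂ in 𝓝 0, τ (ζ • X) ∈ OmegaIII 2 := hmem.mono fun ζ hζ => hτ hζ
  have hback := hasDerivAt_comp_of_eventually_mem hτd' hγ hγmem
  have hXe := hback.unique ((hasDerivAt_smul_matrix X).congr_of_eventuallyEq
    (hmem.mono fun ζ hζ => hl _ hζ))
  have hX0 : X ≠ 0 := fun h0 => one_ne_zero (α := ℂ) (congrFun₂ h0 0 0)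
  have hσ'' := hasDerivAt_comp_of_eventually_mem hσd' (hasDerivAt_ht_smul_diag t)
    (hmem.mono fun ζ hζ => mapsTo_ht ht01 hζ)
  rw [map_zero] at hσ''
  have := eq_zero_of_hasDerivAt_ht_zero ht01' ht1 hγ hγmem.self_of_nhds.1
    (transpose_eq_of_hasDerivAt hγ (hγmem.mono fun ζ hζ => hζ.1))
    (fun hD => hX0 (by rw [← hXe, hD, map_zero]))
    (hσ''.congr_of_eventuallyEq (hmem.mono fun ζ hζ => by
      change _ = σ' (ht t (ζ • X))
      rw [h _ hζ, hl' _ (mapsTo_ht ht01' (hτ hζ))]))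
  simpa using this

lemma differentiableOn_comp_smul {m n : ℕ}
    {f : Matrix (Fin m) (Fin m) ℂ → Matrix (Fin n) (Fin n) ℂ}
    (hf : DifferentiableOn ℂ f (OmegaIII m)) {X : Matrix (Fin m) (Fin m) ℂ}
    (hX : X ∈ symmetricContractions m) (i j : Fin n) :
    DifferentiableOn ℂ (fun ζ : ℂ => f (ζ • X) i j) (Metric.ball 0 1) := by
  have h : DifferentiableOn ℂ (fun ζ : ℂ => f (ζ • X)) (Metric.ball 0 1) :=
    hf.comp (differentiable_id.smul_const X).differentiableOn
      fun ζ hζ => smul_mem_OmegaIII hX hζ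
  exact differentiableOn_pi.1 (differentiableOn_pi.1 h i) j

/-- A Schwarz lemma for the second column of a holomorphic disc in `Ω^III_2`. -/
lemma normSq_add_normSq_le_one {a b : ℂ → ℂ} {a' b' : ℂ}
    (ha : DifferentiableOn ℂ a (Metric.ball 0 1)) (hb : DifferentiableOn ℂ b (Metric.ball 0 1))
    (ha0 : a 0 = 0) (hb0 : b 0 = 0)
    (hab : ∀ ζ ∈ Metric.ball (0 : ℂ) 1, Complex.normSq (a ζ) + Complex.normSq (b ζ) ≤ 1)
    (ha' : HasDerivAt a a' 0) (hb' : HasDerivAt b b' 0) :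
    Complex.normSq a' + Complex.normSq b' ≤ 1 := by
  set n := Complex.normSq a' + Complex.normSq b' with hn
  have hn0 : 0 ≤ n := add_nonneg (Complex.normSq_nonneg _) (Complex.normSq_nonneg _)
  have hbound : ∀ ζ ∈ Metric.ball (0 : ℂ) 1,
      ‖(starRingEnd ℂ) a' * a ζ + (starRingEnd ℂ) b' * b ζ‖ ≤ √n := by
    intro ζ hζ
    refine Real.le_sqrt_of_sq_le ?_
    rw [← Complex.normSq_eq_norm_sq]
    have lagrange : Complex.normSq ((starRingEnd ℂ) a' * a ζ + (starRingEnd ℂ) b' * b ζ) +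
        Complex.normSq (a' * b ζ - b' * a ζ) =
        n * (Complex.normSq (a ζ) + Complex.normSq (b ζ)) := by
      simp only [hn, Complex.normSq_apply, Complex.add_re, Complex.add_im, Complex.mul_re,
        Complex.mul_im, Complex.sub_re, Complex.sub_im, Complex.conj_re, Complex.conj_im]
      ring
    nlinarith [hab ζ hζ, Complex.normSq_nonneg (a' * b ζ - b' * a ζ)]
  have hd := hasDerivAt_norm_le_one ((ha.const_mul _).add (hb.const_mul _))
    (by simp [ha0, hb0]) hbound ((ha'.const_mul _).add (hb'.const_mul _))
  rw [← Complex.normSq_eq_conj_mul_self, ← Complex.normSq_eq_conj_mul_self,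
    ← Complex.ofReal_add, ← hn, Complex.norm_of_nonneg hn0] at hd
  nlinarith [Real.sq_sqrt hn0, Real.sqrt_nonneg n]

lemma mem_symmetricContractions_of_normSq_le {a b : ℂ}
    (hab : Complex.normSq a + Complex.normSq b ≤ 1) :
    !![0, 0, 0, a; 0, 0, 0, b; 0, 0, 0, 0; a, b, 0, 0] ∈ symmetricContractions 4 := by
  refine ⟨by ext i j; fin_cases i <;> fin_cases j <;> rfl, fun v => ?_⟩
  have h : !![0, 0, 0, a; 0, 0, 0, b; 0, 0, 0, 0; a, b, 0, 0] *ᵥ v =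
      ![a * v 3, b * v 3, 0, a * v 0 + b * v 1] := by
    ext i
    fin_cases i <;> simp [mulVec, dotProduct, Fin.sum_univ_four]
  have lagrange : Complex.normSq (a * v 0 + b * v 1) +
      Complex.normSq ((starRingEnd ℂ) a * v 1 - (starRingEnd ℂ) b * v 0) =
      (Complex.normSq a + Complex.normSq b) *
        (Complex.normSq (v 0) + Complex.normSq (v 1)) := by
    simp only [Complex.normSq_apply, Complex.add_re, Complex.add_im, Complex.mul_re,
      Complex.mul_im, Complex.sub_re, Complex.sub_im, Complex.conj_re, Complex.conj_im]
    ring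
  rw [h, vecNormSq_four, vecNormSq_four]
  simp only [cons_val, Complex.normSq_mul, map_zero]
  nlinarith [Complex.normSq_nonneg ((starRingEnd ℂ) a * v 1 - (starRingEnd ℂ) b * v 0),
    Complex.normSq_nonneg (v 0), Complex.normSq_nonneg (v 1), Complex.normSq_nonneg (v 2),
    Complex.normSq_nonneg (v 3),
    mul_nonneg (sub_nonneg.2 hab) (Complex.normSq_nonneg (v 3)),
    mul_nonneg (sub_nonneg.2 hab)
      (add_nonneg (Complex.normSq_nonneg (v 0)) (Complex.normSq_nonneg (v 1)))]

/-- The derivative of `ht t` at the origin, along a curve of symmetric matrices. -/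
lemma exists_hasDerivAt_ht {t : ℝ} (ht01 : t ∈ Set.Icc (0 : ℝ) 1)
    {γ : ℂ → Matrix (Fin 2) (Fin 2) ℂ} {D : Matrix (Fin 2) (Fin 2) ℂ} (hγ : HasDerivAt γ D 0)
    (hγ0 : γ 0 = 0) (hD : Complex.normSq (D 0 1) + Complex.normSq (D 1 1) ≤ 1) :
    ∃ Y ∈ symmetricContractions 4,
      HasDerivAt (fun ζ => ht t (γ ζ)) ((√t : ℂ) • Y) 0 := by
  obtain ⟨r, s, u, c, hc, hs, hu, hst, hsu, hcg, hrc, hH⟩ := ht_coefficients ht01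
  refine ⟨_, mem_symmetricContractions_of_normSq_le (a := D 0 1) (b := c * D 1 1) ?_, ?_⟩
  · rw [normSq_ofReal_mul]
    nlinarith [Complex.normSq_nonneg (D 1 1), mul_nonneg (sq_nonneg (s * c))
      (Complex.normSq_nonneg (D 1 1))]
  · rw [← hu]
    simp only [hH]
    have h1 := hγ.matrix_entry 0 0
    have h2 := hγ.matrix_entry 0 1
    have h3 := hγ.matrix_entry 1 1
    have hz : ∀ i j, γ 0 i j = 0 := fun i j => congrFun₂ hγ0 i j
    have h01 := ((h1.const_mul (r : ℂ)).mul h2).congr_deriv (g' := 0) (by simp [hz])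
    have h02 := ((h2.pow 2).const_mul (s : ℂ)).congr_deriv (g' := 0) (by simp [hz])
    have h12 := ((h2.const_mul (2 * (s * c) : ℂ)).mul h3).congr_deriv (g' := 0) (by simp [hz])
    refine hasDerivAt_matrix fun i j => ?_
    fin_cases i <;> fin_cases j
    · exact (h1.pow 2).congr_deriv (by simp [hz])
    · exact h01.congr_deriv (by simp)
    · exact h02.congr_deriv (by simp)
    · exact h2.const_mul (u : ℂ)
    · exact h01.congr_deriv (by simp)
    · exact (((h1.const_mul (2 * (s * c) ^ 2 : ℂ)).mul h3).add (h2.pow 2)).congr_deriv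
        (by simp [hz])
    · exact h12.congr_deriv (by simp)
    · exact (h3.const_mul (u * c : ℂ)).congr_deriv (mul_assoc _ _ _)
    · exact h02.congr_deriv (by simp)
    · exact h12.congr_deriv (by simp)
    · exact (h3.pow 2).congr_deriv (by simp [hz])
    · exact (hasDerivAt_const _ _).congr_deriv (by simp)
    · exact h2.const_mul (u : ℂ)
    · exact (h3.const_mul (u * c : ℂ)).congr_deriv (mul_assoc _ _ _)
    · exact (hasDerivAt_const _ _).congr_deriv (by simp)
    · exact (hasDerivAt_const _ _).congr_deriv (by simp)

lemma le_of_equivalent {t t' : ℝ} (ht01 : t ∈ Set.Icc (0 : ℝ) 1)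
    (ht01' : t' ∈ Set.Icc (0 : ℝ) 1) (ht1 : t' < 1)
    (h : ∃ τ σ, IsAutomorphismOf (OmegaIII 2) τ ∧ IsAutomorphismOf (OmegaIII 4) σ ∧
        ∀ Z ∈ OmegaIII 2, ht t Z = σ (ht t' (τ Z))) : t ≤ t' := by
  obtain ⟨τ, σ, hτ, hσ, h⟩ := h
  have hτ0 := automorphism_zero_eq_zero ht01' ht1 hτ hσ ht01 h
  have hσ0 : σ 0 = 0 := by
    have := h 0 (zero_mem_OmegaIII 2)
    rwa [hτ0, ht_zero, ht_zero, eq_comm] at this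
  obtain ⟨hτ, hτd, -⟩ := hτ
  obtain ⟨hσ, hσd, -⟩ := hσ
  set X : Matrix (Fin 2) (Fin 2) ℂ := !![0, 1; 1, 0] with hX
  have hXc : X ∈ symmetricContractions 2 := antidiag_mem_symmetricContractions
  have hmem := eventually_smul_mem_OmegaIII hXc
  have hγ := hasDerivAt_comp_of_eventually_mem hτd (hasDerivAt_smul_matrix X) hmem
  have hγ0 : τ ((0 : ℂ) • X) = 0 := by rw [zero_smul, hτ0]
  have hD := normSq_add_normSq_le_one (differentiableOn_comp_smul hτd hXc 0 1)
    (differentiableOn_comp_smul hτd hXc 1 1) (congrFun₂ hγ0 0 1) (congrFun₂ hγ0 1 1)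
    (fun ζ hζ => by
      have := vecNormSq_mulVec_le_of_mem (hτ (smul_mem_OmegaIII hXc hζ)) (Pi.single 1 1)
      rwa [vecNormSq_single, mulVec_single_one, vecNormSq_two] at this)
    (hγ.matrix_entry 0 1) (hγ.matrix_entry 1 1)
  obtain ⟨Y, hY, hYd⟩ := exists_hasDerivAt_ht ht01' hγ hγ0 hD
  have h1 := (hasDerivAt_comp_of_eventually_mem hσd hYd
    (hmem.mono fun ζ hζ => mapsTo_ht ht01' (hτ hζ))).matrix_entry 0 3
  have h2 := (hasDerivAt_comp_of_eventually_mem hσd (hasDerivAt_smul_matrix Y)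
    (eventually_smul_mem_OmegaIII hY)).matrix_entry 0 3
  have h3 : HasDerivAt (fun ζ : ℂ => ht t (ζ • X) 0 3) (√t : ℂ) 0 := by
    have h4 := (hasDerivAt_id (0 : ℂ)).const_mul (√t : ℂ)
    rw [mul_one] at h4
    have h5 : (fun ζ : ℂ => ht t (ζ • X) 0 3) = fun ζ => (√t : ℂ) * id ζ := by
      ext ζ
      simp [ht, hX]
    rwa [h5]
  have h4 := hasDerivAt_norm_le_one (differentiableOn_comp_smul hσd hY 0 3)
    (by rw [zero_smul, hσ0]; rfl) (fun ζ hζ => by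
      have := normSq_entry_le (vecNormSq_mulVec_le_of_mem (hσ (smul_mem_OmegaIII hY hζ))) 0 3
      rw [Complex.normSq_eq_norm_sq] at this
      exact (sq_le_one_iff₀ (norm_nonneg _)).1 this) h2
  have h5 := h3.unique (h1.congr_of_eventuallyEq (hmem.mono fun ζ hζ => congrFun₂ (h _ hζ) 0 3))
  rw [map_smul, hγ0, ht_zero, Matrix.smul_apply, smul_eq_mul] at h5
  rw [zero_smul] at h4
  have h6 := congrArg norm h5
  rw [norm_mul, Complex.norm_of_nonneg (Real.sqrt_nonneg _),
    Complex.norm_of_nonneg (Real.sqrt_nonneg _)] at h6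
  refine (Real.sqrt_le_sqrt_iff ht01'.1).1 ?_
  rw [h6]
  exact mul_le_of_le_one_right (Real.sqrt_nonneg _) h4

lemma not_equivalent {t t' : ℝ} (ht01 : t ∈ Set.Icc (0 : ℝ) 1)
    (ht01' : t' ∈ Set.Icc (0 : ℝ) 1) (htt' : t ≠ t') :
    ¬ ∃ τ σ, IsAutomorphismOf (OmegaIII 2) τ ∧ IsAutomorphismOf (OmegaIII 4) σ ∧
        ∀ Z ∈ OmegaIII 2, ht t Z = σ (ht t' (τ Z)) := by
  intro h
  rcases htt'.lt_or_gt with hlt | hlt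
  · exact hlt.not_ge (le_of_equivalent ht01' ht01 (hlt.trans_le ht01'.2)
      (exists_isAutomorphismOf_symm (mapsTo_ht ht01') h))
  · exact hlt.not_ge (le_of_equivalent ht01 ht01' (hlt.trans_le ht01.2) h)

/-- Corollary 4.4 (n = 2): the maps `h_t`, `t ∈ [0,1]`, are pairwise inequivalent as maps from
`Ω^III_2` to `Ω^III_4`; consequently there are uncountably many pairwise inequivalent proper
holomorphic maps from `Ω^III_2` to `Ω^III_4`. -/
theorem ht_inequivalent (t t' : ℝ)
    (ht01 : t ∈ Set.Icc (0 : ℝ) 1) (ht01' : t' ∈ Set.Icc (0 : ℝ) 1) (htt' : t ≠ t') :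
    (¬ ∃ τ σ, IsAutomorphismOf (OmegaIII 2) τ ∧ IsAutomorphismOf (OmegaIII 4) σ ∧
        ∀ Z ∈ OmegaIII 2, ht t Z = σ (ht t' (τ Z))) ∧
      ∃ S : Set (Matrix (Fin 2) (Fin 2) ℂ → Matrix (Fin 4) (Fin 4) ℂ),
        ¬ S.Countable ∧
        (∀ f ∈ S, Set.MapsTo f (OmegaIII 2) (OmegaIII 4) ∧
          DifferentiableOn ℂ f (OmegaIII 2) ∧
          IsProperOn f (OmegaIII 2) (OmegaIII 4)) ∧
        S.Pairwise (fun f g =>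
          ¬ ∃ τ σ, IsAutomorphismOf (OmegaIII 2) τ ∧ IsAutomorphismOf (OmegaIII 4) σ ∧
            ∀ Z ∈ OmegaIII 2, f Z = σ (g (τ Z))) := by
  refine ⟨not_equivalent ht01 ht01' htt', ht '' Set.Icc 0 1, fun hS => ?_, ?_, ?_⟩
  · have hinj : Set.InjOn ht (Set.Icc 0 1) := fun a ha b hb hab => by_contra fun hne =>
      not_equivalent ha hb hne ⟨id, id, isAutomorphismOf_id _, isAutomorphismOf_id _,
        fun Z _ => congrFun hab Z⟩
    have := Set.countable_of_injective_of_countable_image hinj hS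
    exact zero_lt_one.not_ge (Cardinal.Real.Icc_countable_iff.1 this)
  · rintro _ ⟨a, ha, rfl⟩
    exact ⟨mapsTo_ht ha, (differentiable_ht a).differentiableOn, isProperOn_ht ha⟩
  · rintro _ ⟨a, ha, rfl⟩ _ ⟨b, hb, rfl⟩ hab
    exact not_equivalent ha hb fun h => hab (congrArg ht h)
end
end
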